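/- Fixpoint theorem: Let Q be a quantale whose underlying complete lattice is continuous, C a Cauchy-complete Q-category on X, φ a sequentially lower-semicontinuous control function on Q, and f : X → X a φ-contraction. If there exists x ∈ X with C(x, f x) ≠ 0 and C(f x, x) ≠ 0, then f has a fixpoint: there exists u ∈ X with C(y, u) = ⨆_{N∈ℕ} ⨅_{n ≥ N} C(y, f^n x) and C(u, y) = ⨆_{N∈ℕ} ⨅_{n ≥ N} C(f^n x, y) for all y ∈ X, and this u satisfies 1 ≤ C(f u, u) and 1 ≤ C(u, f u). -/

import Mathlib

/-- `a` is way below `b` in a complete lattice. -/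
def WayBelow {L : Type*} [CompleteLattice L] (a b : L) : Prop :=
  ∀ D : Set L, D.Nonempty → DirectedOn (· ≤ ·) D → b ≤ sSup D → ∃ d ∈ D, a ≤ d

/-- A complete lattice is continuous if every element is the supremum of the
elements way below it. -/
def IsContinuousLattice (L : Type*) [CompleteLattice L] : Prop :=
  ∀ a : L, a = sSup {u | WayBelow u a}

section LimInf

variable {Q : Type*} [CompleteLattice Q]

theorem le_iSup_iInf_of_forall_ge {t : ℕ → Q} {e : Q} (N : ℕ) (h : ∀ n ≥ N, e ≤ t n) :
    e ≤ ⨆ N, ⨅ n ≥ N, t n :=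
  le_iSup_of_le N (le_iInf₂ h)

theorem iSup_iInf_mono {s t : ℕ → Q} (h : ∀ n, s n ≤ t n) :
    (⨆ N, ⨅ n ≥ N, s n) ≤ ⨆ N, ⨅ n ≥ N, t n :=
  iSup_mono fun _ => iInf₂_mono fun n _ => h n

theorem iSup_iInf_le_of_succ_le {s t : ℕ → Q} (h : ∀ n, s n ≤ t (n + 1)) :
    (⨆ N, ⨅ n ≥ N, s n) ≤ ⨆ N, ⨅ n ≥ N, t n := by
  refine iSup_le fun N => le_iSup_iInf_of_forall_ge (N + 1) fun n hn => ?_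
  obtain ⟨k, rfl⟩ : ∃ k, n = k + 1 := ⟨n - 1, by omega⟩
  exact (iInf₂_le k (by omega)).trans (h k)

theorem monotone_iInf_ge (t : ℕ → Q) : Monotone fun N => ⨅ n ≥ N, t n :=
  fun _ _ h => le_iInf₂ fun n hn => iInf₂_le n (h.trans hn)

theorem WayBelow.exists_le_of_le_iSup {a b : Q} (h : WayBelow a b) {s : ℕ → Q}
    (hs : Monotone s) (hb : b ≤ ⨆ n, s n) : ∃ n, a ≤ s n := by
  obtain ⟨_, ⟨n, rfl⟩, hn⟩ := h (Set.range s) (Set.range_nonempty s)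
    (directedOn_range.2 hs.directed_le) hb
  exact ⟨n, hn⟩

theorem WayBelow.le {a b : Q} (h : WayBelow a b) : a ≤ b := by
  obtain ⟨n, hn⟩ := h.exists_le_of_le_iSup (s := fun _ => b) monotone_const (by simp)
  exact hn

theorem WayBelow.exists_forall_ge_le {a b : Q} (h : WayBelow a b) {t : ℕ → Q}
    (hb : b ≤ ⨆ N, ⨅ n ≥ N, t n) : ∃ N, ∀ n ≥ N, a ≤ t n := by
  obtain ⟨N, hN⟩ := h.exists_le_of_le_iSup (monotone_iInf_ge t) hb
  exact ⟨N, fun n hn => hN.trans (iInf₂_le n hn)⟩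

end LimInf

section ControlFunction

variable {Q : Type*} [Monoid Q] [CompleteLattice Q] {φ : Q → Q}

theorem bot_or_one_le_of_le (hφ_le : ∀ t, t ≤ φ t) (hφ_fix : ∀ t, φ t = t → t = ⊥ ∨ 1 ≤ t)
    {t : Q} (h : φ t ≤ t) : t = ⊥ ∨ 1 ≤ t :=
  hφ_fix t (h.antisymm (hφ_le t))

theorem monotone_and_one_le_iSup_of_control (hφ_le : ∀ t, t ≤ φ t)
    (hφ_fix : ∀ t, φ t = t → t = ⊥ ∨ 1 ≤ t)
    (hφ_lsc : ∀ t : ℕ → Q, φ (⨆ N, ⨅ n ≥ N, t n) ≤ ⨆ N, ⨅ n ≥ N, φ (t n))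
    {a : ℕ → Q} (ha : ∀ n, φ (a n) ≤ a (n + 1)) (h0 : a 0 ≠ ⊥) :
    Monotone a ∧ 1 ≤ ⨆ n, a n := by
  have hmono : Monotone a := monotone_nat_of_le_succ fun n => (hφ_le _).trans (ha n)
  refine ⟨hmono, ?_⟩
  have hle : 1 ≤ ⨆ N, ⨅ n ≥ N, a n := by
    refine (bot_or_one_le_of_le hφ_le hφ_fix
      ((hφ_lsc a).trans (iSup_iInf_le_of_succ_le ha))).resolve_left fun h => h0 ?_
    exact le_bot_iff.1 (h ▸ le_iSup_iInf_of_forall_ge 0 fun n _ => hmono n.zero_le)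
  exact hle.trans (iSup_mono fun N => iInf₂_le N le_rfl)

/-- A Boyd–Wong style argument: a double sequence that `φ` pushes along the diagonal, and whose
entries are asymptotically comparable to their neighbours, is eventually above anything way
below the unit. -/
theorem WayBelow.exists_forall_le_of_control (hφ_le : ∀ t, t ≤ φ t)
    (hφ_fix : ∀ t, φ t = t → t = ⊥ ∨ 1 ≤ t)
    (hφ_lsc : ∀ t : ℕ → Q, φ (⨆ N, ⨅ n ≥ N, t n) ≤ ⨆ N, ⨅ n ≥ N, φ (t n))
    {T : ℕ → ℕ → Q} (hT_one : ∀ n, 1 ≤ T n n)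
    (hT : ∀ n m, φ (T n m) ≤ T (n + 1) (m + 1))
    {g h : ℕ → Q → Q} (hg_mono : ∀ k, Monotone (g k)) (hh_mono : ∀ k, Monotone (h k))
    (hg : ∀ e, e ≤ ⨆ k, g k e) (hh : ∀ e, e ≤ ⨆ k, h k e)
    (hgT : ∀ k n m, k ≤ m → g k (T n m) ≤ T n (m + 1))
    (hhT : ∀ k n m, k ≤ n → k ≤ m → h k (T (n + 1) (m + 1)) ≤ T n m)
    {e : Q} (he : WayBelow e 1) : ∃ N, ∀ n ≥ N, ∀ m ≥ n, e ≤ T n m := by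
  by_contra! hne
  have key : ∀ N, ∃ n m, N ≤ n ∧ n ≤ m ∧ e ≤ T n m ∧ ¬ e ≤ T n (m + 1) := by
    intro N
    obtain ⟨n, hn, m, hm, hnm⟩ := hne N
    by_contra! hcon
    refine hnm ?_
    clear hnm
    induction m, hm using Nat.le_induction with
    | base => exact he.le.trans (hT_one n)
    | succ m hm ih => exact hcon n m hn hm ih
  choose n m hn hm hle hnle using key
  set t : Q := ⨆ N, ⨅ k ≥ N, T (n k) (m k + 1)
  have het : e ≤ t := (hg e).trans <| iSup_le fun k =>
    le_iSup_iInf_of_forall_ge k fun j hj =>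
      (hg_mono k (hle j)).trans (hgT k _ _ (hj.trans ((hn j).trans (hm j))))
  have hshift : (⨆ N, ⨅ k ≥ N, T (n k + 1) (m k + 1 + 1)) ≤ t := by
    refine iSup_le fun N => (hh _).trans <| iSup_le fun k =>
      le_iSup_iInf_of_forall_ge (max N k) fun j hj => ?_
    have hkj : k ≤ n j := (le_of_max_le_right hj).trans (hn j)
    exact (hh_mono k (iInf₂_le j (le_of_max_le_left hj))).trans
      (hhT k _ _ hkj (by have := hm j; omega))
  have hφt : φ t ≤ t := (hφ_lsc _).trans ((iSup_iInf_mono fun k => hT _ _).trans hshift)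
  rcases bot_or_one_le_of_le hφ_le hφ_fix hφt with h0 | h1
  · exact hnle 0 ((het.trans h0.le).trans bot_le)
  · obtain ⟨N, hN⟩ := he.exists_forall_ge_le h1
    exact hnle N (hN N le_rfl)

end ControlFunction

section Quantale

variable {Q : Type*} [Monoid Q] [CompleteLattice Q] [IsQuantale Q]

theorem le_iSup_mul_right {a : ℕ → Q} (ha : 1 ≤ ⨆ n, a n) (e : Q) : e ≤ ⨆ n, e * a n := by
  rw [← Quantale.mul_iSup_distrib]
  exact le_mul_of_one_le_right' ha

theorem le_iSup_mul_left {a : ℕ → Q} (ha : 1 ≤ ⨆ n, a n) (e : Q) : e ≤ ⨆ n, a n * e := by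
  rw [← Quantale.iSup_mul_distrib]
  exact le_mul_of_one_le_left' ha

theorem le_iSup_mul_mul {a b : ℕ → Q} (ha_mono : Monotone a) (hb_mono : Monotone b)
    (ha : 1 ≤ ⨆ n, a n) (hb : 1 ≤ ⨆ n, b n) (e : Q) : e ≤ ⨆ n, a n * e * b n := by
  refine (le_iSup_mul_left ha e).trans <| iSup_le fun i =>
    (le_iSup_mul_right hb _).trans <| iSup_le fun j => le_iSup_of_le (max i j) ?_
  gcongr
  · exact ha_mono (le_max_left i j)
  · exact hb_mono (le_max_right i j)

variable {X : Type*} {C : X → X → Q}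

/-- A sequence in a Cauchy-complete `Q`-category that is Cauchy has a representing object. -/
theorem exists_representing_of_cauchy (hC_comp : ∀ x y z, C x y * C y z ≤ C x z)
    (hcc : ∀ φ ψ : X → Q,
      (∀ y y', C y' y * φ y ≤ φ y') →
      (∀ y y', ψ y * C y y' ≤ ψ y') →
      (1 ≤ ⨆ y, ψ y * φ y) →
      (∀ y y', φ y * ψ y' ≤ C y y') →
      ∃ u, (∀ y, φ y = C y u) ∧ (∀ y, ψ y = C u y))
    (s : ℕ → X) (hs : 1 ≤ ⨆ N, ⨅ n ≥ N, ⨅ m ≥ N, C (s n) (s m)) :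
    ∃ u, (∀ y, C y u = ⨆ N, ⨅ n ≥ N, C y (s n)) ∧
      (∀ y, C u y = ⨆ N, ⨅ n ≥ N, C (s n) y) := by
  have hmono : Monotone fun N => ⨅ n ≥ N, ⨅ m ≥ N, C (s n) (s m) := fun N M h =>
    le_iInf₂ fun n hn => le_iInf₂ fun m hm =>
      (iInf₂_le n (h.trans hn)).trans (iInf₂_le m (h.trans hm))
  have hle : ∀ {N n m}, N ≤ n → N ≤ m →
      (⨅ n ≥ N, ⨅ m ≥ N, C (s n) (s m)) ≤ C (s n) (s m) := fun {N n m} hn hm =>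
    (iInf₂_le n hn).trans (iInf₂_le m hm)
  simp only [eq_comm (a := C _ _)]
  refine hcc (fun y => ⨆ N, ⨅ n ≥ N, C y (s n)) (fun y => ⨆ N, ⨅ n ≥ N, C (s n) y) ?_ ?_ ?_ ?_
  · intro y y'
    simp only [Quantale.mul_iSup_distrib]
    refine iSup_le fun N => le_iSup_iInf_of_forall_ge N fun n hn => ?_
    exact (mul_le_mul_right (iInf₂_le n hn) _).trans (hC_comp _ _ _)
  · intro y y'
    simp only [Quantale.iSup_mul_distrib]
    refine iSup_le fun N => le_iSup_iInf_of_forall_ge N fun n hn => ?_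
    exact (mul_le_mul_left (iInf₂_le n hn) _).trans (hC_comp _ _ _)
  · refine (le_iSup_mul_mul hmono hmono hs hs 1).trans <| iSup_le fun N =>
      le_iSup_of_le (s N) ?_
    rw [mul_one]
    exact mul_le_mul' (le_iSup_iInf_of_forall_ge N fun n hn => hle hn le_rfl)
      (le_iSup_iInf_of_forall_ge N fun n hn => hle le_rfl hn)
  · intro y y'
    simp only [Quantale.iSup_mul_distrib, Quantale.mul_iSup_distrib]
    refine iSup_le fun N => iSup_le fun M => ?_
    exact (mul_le_mul' (iInf₂_le (max N M) (by simp)) (iInf₂_le (max N M) (by simp))).trans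
      (hC_comp _ (s (max N M)) _)

end Quantale

/-- Fixpoint theorem: over a quantale with continuous underlying
lattice, any `φ`-contraction (with sequentially lower-semicontinuous control
function `φ`) on a Cauchy-complete `Q`-category, admitting a point `x` with
`C(x,fx) ≠ 0 ≠ C(fx,x)`, has a fixpoint, namely the object representing the
adjunction `φ_{x,f} ⊣ ψ_{x,f}`. -/
theorem fixpoint_theorem
    {Q : Type*} [Monoid Q] [CompleteLattice Q] [IsQuantale Q]
    (hQ : IsContinuousLattice Q)
    {X : Type*} (C : X → X → Q)
    (hC_id : ∀ x, 1 ≤ C x x)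
    (hC_comp : ∀ x y z, C x y * C y z ≤ C x z)
    (hcc : ∀ φ ψ : X → Q,
      (∀ y y', C y' y * φ y ≤ φ y') →
      (∀ y y', ψ y * C y y' ≤ ψ y') →
      (1 ≤ ⨆ y, ψ y * φ y) →
      (∀ y y', φ y * ψ y' ≤ C y y') →
      ∃ u, (∀ y, φ y = C y u) ∧ (∀ y, ψ y = C u y))
    (φ : Q → Q)
    (hφ_le : ∀ t, t ≤ φ t)
    (hφ_fix : ∀ t, φ t = t → t = ⊥ ∨ 1 ≤ t)
    (hφ_lsc : ∀ t : ℕ → Q, φ (⨆ N, ⨅ n ≥ N, t n) ≤ ⨆ N, ⨅ n ≥ N, φ (t n))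
    (f : X → X)
    (hf : ∀ x y, φ (C x y) ≤ C (f x) (f y))
    (x : X) (hx₁ : C x (f x) ≠ ⊥) (hx₂ : C (f x) x ≠ ⊥) :
    ∃ u : X,
      (∀ y, C y u = ⨆ N, ⨅ n ≥ N, C y (f^[n] x)) ∧
      (∀ y, C u y = ⨆ N, ⨅ n ≥ N, C (f^[n] x) y) ∧
      1 ≤ C (f u) u ∧ 1 ≤ C u (f u) := by
  have hstep : ∀ n m, φ (C (f^[n] x) (f^[m] x)) ≤ C (f^[n + 1] x) (f^[m + 1] x) := by
    intro n m
    simpa only [Function.iterate_succ_apply'] using hf (f^[n] x) (f^[m] x)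
  obtain ⟨ha_mono, ha⟩ := monotone_and_one_le_iSup_of_control hφ_le hφ_fix hφ_lsc
    (a := fun n => C (f^[n] x) (f^[n + 1] x)) (fun n => hstep n (n + 1)) hx₁
  obtain ⟨hb_mono, hb⟩ := monotone_and_one_le_iSup_of_control hφ_le hφ_fix hφ_lsc
    (a := fun n => C (f^[n + 1] x) (f^[n] x)) (fun n => hstep (n + 1) n) hx₂
  have hsandwich : ∀ k n m, k ≤ n → k ≤ m →
      C (f^[k] x) (f^[k + 1] x) * C (f^[n + 1] x) (f^[m + 1] x) * C (f^[k + 1] x) (f^[k] x) ≤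
        C (f^[n] x) (f^[m] x) := fun k n m hn hm =>
    (mul_le_mul' (mul_le_mul' (ha_mono hn) le_rfl) (hb_mono hm)).trans
      ((mul_le_mul' (hC_comp _ _ _) le_rfl).trans (hC_comp _ _ _))
  have hmul_mono : ∀ k, Monotone fun e =>
      C (f^[k] x) (f^[k + 1] x) * e * C (f^[k + 1] x) (f^[k] x) := fun k _ _ h =>
    mul_le_mul' (mul_le_mul' le_rfl h) le_rfl
  have hcauchy : 1 ≤ ⨆ N, ⨅ n ≥ N, ⨅ m ≥ N, C (f^[n] x) (f^[m] x) := by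
    rw [hQ 1]
    refine sSup_le fun e (he : WayBelow e 1) => ?_
    obtain ⟨N, hN⟩ := he.exists_forall_le_of_control hφ_le hφ_fix hφ_lsc
      (T := fun n m => C (f^[n] x) (f^[m] x)) (fun n => hC_id _) hstep
      (g := fun k e => e * C (f^[k] x) (f^[k + 1] x))
      (fun k _ _ h => mul_le_mul' h le_rfl) hmul_mono
      (le_iSup_mul_right ha) (le_iSup_mul_mul ha_mono hb_mono ha hb)
      (fun k n m hk => (mul_le_mul' le_rfl (ha_mono hk)).trans (hC_comp _ _ _)) hsandwich
    obtain ⟨M, hM⟩ := he.exists_forall_le_of_control hφ_le hφ_fix hφ_lsc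
      (T := fun n m => C (f^[m] x) (f^[n] x)) (fun n => hC_id _) (fun n m => hstep m n)
      (g := fun k e => C (f^[k + 1] x) (f^[k] x) * e)
      (fun k _ _ h => mul_le_mul' le_rfl h) hmul_mono
      (le_iSup_mul_left hb) (le_iSup_mul_mul ha_mono hb_mono ha hb)
      (fun k n m hk => (mul_le_mul' (hb_mono hk) le_rfl).trans (hC_comp _ _ _))
      (fun k n m hn hm => hsandwich k m n hm hn)
    refine le_iSup_of_le (max N M) (le_iInf₂ fun n hn => le_iInf₂ fun m hm => ?_)
    rcases le_total n m with h | h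
    · exact hN n (le_of_max_le_left hn) m h
    · exact hM m (le_of_max_le_right hm) n h
  obtain ⟨u, hu₁, hu₂⟩ := exists_representing_of_cauchy hC_comp hcc (fun n => f^[n] x) hcauchy
  refine ⟨u, hu₁, hu₂, ?_, ?_⟩
  · rw [hu₁ (f u)]
    refine ((hC_id u).trans (hu₁ u).le).trans (iSup_iInf_le_of_succ_le fun n => ?_)
    rw [Function.iterate_succ_apply']
    exact (hφ_le _).trans (hf _ _)
  · rw [hu₂ (f u)]
    refine ((hC_id u).trans (hu₂ u).le).trans (iSup_iInf_le_of_succ_le fun n => ?_)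
    rw [Function.iterate_succ_apply']
    exact (hφ_le _).trans (hf _ _)
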